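/- (Boundary Pohozaev integral of the concentrated potential.) For all constants δ₀, κ₁, κ₀, R, K > 0 with κ₁ ≤ κ₀ and every δ ∈ (0, δ₀/2] there exist C > 0 and ε₀ > 0 with the following property. Let ε ∈ (0, ε₀], z = (z₁, 0) with δ₀ ≤ z₁ ≤ 1/δ₀, and let A ⊆ B_{Rε}(z) be a measurable set with κ := ε^{−2} ∫_A x₁ dx ∈ [κ₁, κ₀]; set s₀ := ε √(κ/(π z₁)), assume the Lebesgue measure e of the symmetric difference A Δ B_{s₀}(z) satisfies e ≤ K ε, and define ψ₁(x) := (z₁²/(2π ε²)) ∫_A ln(|x − x̄'|/|x − x'|) dx' for x ∈ Π. Then | −∫_{∂B_δ(z)} (∂ψ₁/∂ν)(∂ψ₁/∂x₁) dσ + (1/2) ∫_{∂B_δ(z)} |∇ψ₁|² ν₁ dσ − κ² z₁/(4π) | ≤ C e/ε, where ν = (ν₁, ν₂) is the outward unit normal to the circle ∂B_δ(z) and dσ its arc-length measure. -/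

import Mathlib

open MeasureTheory Real Filter
open scoped RealInnerProductSpace

noncomputable section

/-- The plane `ℝ²` with the Euclidean norm. -/
abbrev Plane : Type := EuclideanSpace ℝ (Fin 2)

/-- The point `(a, b)` of the plane. -/
def mk2 (a b : ℝ) : Plane := (WithLp.equiv 2 (Fin 2 → ℝ)).symm ![a, b]

/-- The open right half plane `Π = {x : x₁ > 0}`. -/
def halfPlane : Set Plane := {x : Plane | 0 < x 0}

/-- The reflection `x̄ = (−x₁, x₂)` of a point `x = (x₁, x₂)`. -/
def reflPt (x : Plane) : Plane := mk2 (-(x 0)) (x 1)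

/-- The Green function `G_*` on the half plane of the operator `−(1/x₁)div((1/x₁)∇)`. -/
def Gstar (x x' : Plane) : ℝ :=
  x 0 * (x' 0) ^ 2 / (4 * π) *
    ∫ θ in (-π)..π, Real.cos θ /
      Real.sqrt ((x 1 - x' 1) ^ 2 + (x 0) ^ 2 + (x' 0) ^ 2 - 2 * x 0 * x' 0 * Real.cos θ)

/-- The Green function of `−Δ` on the half plane. -/
def Gfun (x x' : Plane) : ℝ :=
  (1 / (4 * π)) * Real.log
    (((x 0 + x' 0) ^ 2 + (x 1 - x' 1) ^ 2) / ((x 0 - x' 0) ^ 2 + (x 1 - x' 1) ^ 2))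

/-- The regular part `H_c(x,x') = G_*(x,x') − c² G(x,x')`. -/
def Hker (c : ℝ) (x x' : Plane) : ℝ := Gstar x x' - c ^ 2 * Gfun x x'

/-- The regular part `H_c`, extended continuously to the diagonal. -/
def HkerExt (c : ℝ) (x x' : Plane) : ℝ := by
  classical
  exact if x = x' then limUnder (nhdsWithin x' {x'}ᶜ) (fun y => Hker c y x')
    else Hker c x x'

/-- The cross-section `A = {x ∈ Π : ψ(x) − (W/2) x₁² ln(1/ε) > μ}`. -/
def crossSection (ψ : Plane → ℝ) (ε W μ : ℝ) : Set Plane :=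
  {x : Plane | x ∈ halfPlane ∧ μ < ψ x - W / 2 * (x 0) ^ 2 * Real.log (1 / ε)}

/-- `ψ` is a stream function of a steady vortex ring with parameters `(ε, W, μ)`. -/
structure IsVortexRingStream (ψ : Plane → ℝ) (ε W μ : ℝ) : Prop where
  continuousOn : ContinuousOn ψ halfPlane
  bounded : Bornology.IsBounded (crossSection ψ ε W μ)
  closure_subset : closure (crossSection ψ ε W μ) ⊆ halfPlane
  repr : ∀ x ∈ halfPlane, ψ x = (∫ x' in crossSection ψ ε W μ, Gstar x x') / ε ^ 2

/-- The circulation `ε⁻² ∫_A x₁ dx` of a vortex ring. -/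
def circulation (ψ : Plane → ℝ) (ε W μ : ℝ) : ℝ :=
  (∫ x in crossSection ψ ε W μ, x 0) / ε ^ 2

/-- `ψ` is centralized: it is even in the second variable. -/
def Centralized (ψ : Plane → ℝ) : Prop :=
  ∀ a b : ℝ, ψ (mk2 a (-b)) = ψ (mk2 a b)

theorem norm_circleMap_sub (z : ℂ) {δ : ℝ} (hδ : 0 ≤ δ) (a b : ℝ) :
    ‖circleMap z δ b - circleMap z δ a‖ = 2 * δ * |Real.sin ((b - a) / 2)| := by
  have h : circleMap z δ b - circleMap z δ a
      = δ * Complex.exp (a * Complex.I) * (Complex.exp (Complex.I * ((b - a : ℝ) : ℂ)) - 1) := by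
    have : (b : ℂ) * Complex.I = a * Complex.I + Complex.I * ((b - a : ℝ) : ℂ) := by
      push_cast; ring
    simp only [circleMap]
    rw [this, Complex.exp_add]
    ring
  rw [h, norm_mul, norm_mul, Complex.norm_exp_I_mul_ofReal_sub_one, Complex.norm_exp_ofReal_mul_I,
    Complex.norm_real, Real.norm_eq_abs, Real.norm_eq_abs, abs_of_nonneg hδ, abs_mul, abs_two]
  ring

theorem chord_le_hausdorffMeasure_arc (z : ℂ) {δ : ℝ} (hδ : 0 ≤ δ) {a b : ℝ} (hab : a ≤ b) :
    ENNReal.ofReal (2 * δ * |Real.sin ((b - a) / 2)|)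
      ≤ μH[1] (circleMap z δ '' Set.Ioc a b) := by
  set f : ℂ → ℝ := fun w => dist w (circleMap z δ a)
  have hf : LipschitzWith 1 f := LipschitzWith.dist_left _
  have h1 := hf.hausdorffMeasure_image_le (d := 1) zero_le_one (circleMap z δ '' Set.Ioc a b)
  have h2 : Set.Ioc (f (circleMap z δ a)) (f (circleMap z δ b))
      ⊆ f '' (circleMap z δ '' Set.Ioc a b) := by
    rw [Set.image_image]
    exact intermediate_value_Ioc hab
      (hf.continuous.comp (continuous_circleMap z δ)).continuousOn
  have h3 := (measure_mono h2).trans h1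
  rw [hausdorffMeasure_real, Real.volume_Ioc] at h3
  simpa [f, dist_eq_norm, norm_circleMap_sub z hδ] using h3

theorem natCast_mul_chord_le_hausdorffMeasure_sphere (z : ℂ) {δ : ℝ} (hδ : 0 < δ) (n : ℕ) :
    ENNReal.ofReal ((n + 1 : ℕ) * (2 * δ * |Real.sin (π / (n + 1 : ℕ))|))
      ≤ μH[1] (Metric.sphere z δ) := by
  set N : ℕ := n + 1
  have hN : (0 : ℝ) < N := by positivity
  set t : ℕ → ℝ := fun k => 2 * π / N * k
  have ht : Monotone t := fun i j hij => by
    simp only [t]; gcongr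
  have htN : t N = 2 * π := by simp only [t]; field_simp
  have hsub : ∀ k ∈ Finset.range N, Set.Ioc (t k) (t (k + 1)) ⊆ Set.Ioc 0 (2 * π) := by
    intro k hk
    refine Set.Ioc_subset_Ioc ?_ ?_
    · simp only [t]; positivity
    · rw [← htN]; exact ht (Finset.mem_range.1 hk)
  have hinj : Set.InjOn (circleMap z δ) (Set.Ioc 0 (2 * π)) := by
    have := injOn_circleMap_of_abs_sub_le (c := z) (a := 0) (b := 2 * π) hδ.ne'
      (by rw [zero_sub, abs_neg, abs_of_pos Real.two_pi_pos])
    rwa [Set.uIoc_of_le Real.two_pi_pos.le] at this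
  have hdisj : Set.PairwiseDisjoint (↑(Finset.range N))
      (fun k : ℕ => circleMap z δ '' Set.Ioc (t k) (t (k + 1))) := by
    intro i hi j hj hij
    exact (ht.pairwise_disjoint_on_Ioc_succ hij).image hinj (hsub i hi) (hsub j hj)
  have hmeas : ∀ k ∈ Finset.range N,
      MeasurableSet (circleMap z δ '' Set.Ioc (t k) (t (k + 1))) := fun k hk =>
    measurableSet_Ioc.image_of_continuousOn_injOn (continuous_circleMap z δ).continuousOn
      (hinj.mono (hsub k hk))
  calc ENNReal.ofReal (N * (2 * δ * |Real.sin (π / N)|))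
      = ∑ k ∈ Finset.range N, ENNReal.ofReal (2 * δ * |Real.sin ((t (k + 1) - t k) / 2)|) := by
        have : ∀ k ∈ Finset.range N, ENNReal.ofReal (2 * δ * |Real.sin ((t (k + 1) - t k) / 2)|)
            = ENNReal.ofReal (2 * δ * |Real.sin (π / N)|) := fun k _ => by
          have h : (t (k + 1) - t k) / 2 = π / N := by
            simp only [t]; push_cast; ring
          rw [h]
        rw [Finset.sum_congr rfl this, Finset.sum_const, Finset.card_range, nsmul_eq_mul,
          ENNReal.ofReal_mul hN.le, ENNReal.ofReal_natCast]
    _ ≤ ∑ k ∈ Finset.range N, μH[1] (circleMap z δ '' Set.Ioc (t k) (t (k + 1))) :=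
        Finset.sum_le_sum fun k _ => chord_le_hausdorffMeasure_arc z hδ.le (ht (Nat.le_succ k))
    _ = μH[1] (⋃ k ∈ Finset.range N, circleMap z δ '' Set.Ioc (t k) (t (k + 1))) :=
        (measure_biUnion_finset hdisj hmeas).symm
    _ ≤ μH[1] (Metric.sphere z δ) := by
        refine measure_mono (Set.iUnion₂_subset fun k _ => ?_)
        rintro _ ⟨θ, _, rfl⟩
        exact circleMap_mem_sphere z hδ.le θ

theorem two_pi_mul_le_hausdorffMeasure_sphere (z : ℂ) {δ : ℝ} (hδ : 0 < δ) :
    ENNReal.ofReal (2 * π * δ) ≤ μH[1] (Metric.sphere z δ) := by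
  have hlim : Tendsto (fun n : ℕ => ((n + 1 : ℕ) : ℝ) * (2 * δ * |Real.sin (π / (n + 1 : ℕ))|))
      atTop (nhds (2 * π * δ)) := by
    have h0 : Tendsto (fun x : ℝ => x⁻¹ * Real.sin x) (nhdsWithin 0 {0}ᶜ) (nhds 1) := by
      have := (hasDerivAt_iff_tendsto_slope_zero.1 (Real.hasDerivAt_sin 0))
      simpa using this
    have h1 : Tendsto (fun n : ℕ => π / ((n + 1 : ℕ) : ℝ)) atTop (nhdsWithin 0 {0}ᶜ) := by
      refine tendsto_nhdsWithin_iff.2 ⟨?_, Eventually.of_forall fun n => ?_⟩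
      · exact (tendsto_const_div_atTop_nhds_zero_nat π).comp (tendsto_add_atTop_nat 1)
      · simp only [Set.mem_compl_iff, Set.mem_singleton_iff]
        positivity
    have h2 := ((h0.comp h1).abs).const_mul (2 * π * δ)
    rw [abs_one, mul_one] at h2
    refine h2.congr fun n => ?_
    have hn : (0 : ℝ) < ((n + 1 : ℕ) : ℝ) := by positivity
    simp only [Function.comp_apply, abs_mul, abs_inv, abs_div, abs_of_pos hn, abs_of_pos pi_pos]
    field_simp
  exact le_of_tendsto' ((ENNReal.continuous_ofReal.tendsto _).comp hlim)
    (natCast_mul_chord_le_hausdorffMeasure_sphere z hδ)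

/-- One-dimensional Hausdorff measure on a circle is the arc-length measure. -/
theorem hausdorffMeasure_restrict_sphere (z : ℂ) {δ : ℝ} (hδ : 0 < δ) :
    (μH[1] : Measure ℂ).restrict (Metric.sphere z δ)
      = ENNReal.ofReal δ • (volume.restrict (Set.Ioc 0 (2 * π))).map (circleMap z δ) := by
  have him : circleMap z δ '' Set.Ioc 0 (2 * π) = Metric.sphere z δ := by
    rw [image_circleMap_Ioc, abs_of_pos hδ]
  have hle : (μH[1] : Measure ℂ).restrict (Metric.sphere z δ)
      ≤ ENNReal.ofReal δ • (volume.restrict (Set.Ioc 0 (2 * π))).map (circleMap z δ) := by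
    refine Measure.le_iff.2 fun S hS => ?_
    rw [Measure.restrict_apply hS, Measure.smul_apply, Measure.map_apply (measurable_circleMap z δ) hS,
      Measure.restrict_apply (measurable_circleMap z δ hS), ← him, Set.inter_comm,
      ← Set.image_inter_preimage]
    refine ((lipschitzWith_circleMap z δ).hausdorffMeasure_image_le zero_le_one _).trans ?_
    rw [hausdorffMeasure_real, ENNReal.rpow_one, smul_eq_mul, ENNReal.ofReal, Set.inter_comm]
    rw [Real.toNNReal_of_nonneg hδ.le, Real.nnabs_of_nonneg hδ.le, Real.toNNReal_of_nonneg hδ.le]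
  have huniv : (ENNReal.ofReal δ • (volume.restrict (Set.Ioc 0 (2 * π))).map (circleMap z δ))
      Set.univ = ENNReal.ofReal (2 * π * δ) := by
    rw [Measure.smul_apply, Measure.map_apply (measurable_circleMap z δ) MeasurableSet.univ,
      Set.preimage_univ, Measure.restrict_apply_univ, Real.volume_Ioc, smul_eq_mul,
      ← ENNReal.ofReal_mul hδ.le]
    congr 1; ring
  have : IsFiniteMeasure ((μH[1] : Measure ℂ).restrict (Metric.sphere z δ)) :=
    ⟨(hle Set.univ).trans_lt (by rw [huniv]; exact ENNReal.ofReal_lt_top)⟩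
  have : IsFiniteMeasure
      (ENNReal.ofReal δ • (volume.restrict (Set.Ioc 0 (2 * π))).map (circleMap z δ)) :=
    ⟨by rw [huniv]; exact ENNReal.ofReal_lt_top⟩
  refine Measure.eq_of_le_of_measure_univ_eq hle (le_antisymm (hle _) ?_)
  rw [huniv, Measure.restrict_apply_univ]
  exact two_pi_mul_le_hausdorffMeasure_sphere z hδ

/-- Integration over a circle with respect to one-dimensional Hausdorff measure. -/
theorem setIntegral_sphere_hausdorffMeasure (z : ℂ) {δ : ℝ} (hδ : 0 < δ) {F : ℂ → ℝ}
    (hF : Measurable F) :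
    ∫ w in Metric.sphere z δ, F w ∂μH[1]
      = δ * ∫ θ in (0)..(2 * π), F (circleMap z δ θ) := by
  rw [hausdorffMeasure_restrict_sphere z hδ, integral_smul_measure,
    integral_map (measurable_circleMap z δ).aemeasurable hF.aestronglyMeasurable,
    ENNReal.toReal_ofReal hδ.le, intervalIntegral.integral_of_le Real.two_pi_pos.le, smul_eq_mul]

/-- The mean value property of holomorphic functions over discs. -/
theorem setIntegral_ball_of_differentiableOn {z : ℂ} {s : ℝ} (hs : 0 ≤ s) {f : ℂ → ℂ}
    (hf : DifferentiableOn ℂ f (Metric.closedBall z s)) :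
    ∫ x in Metric.ball z s, f x = ((π * s ^ 2 : ℝ) : ℂ) * f z := by
  have hpolar : ∀ p : ℝ × ℝ, z + Complex.polarCoord.symm p = circleMap z p.1 p.2 := fun p => by
    rw [Complex.polarCoord_symm_apply, circleMap, Complex.exp_mul_I]
    push_cast; rfl
  have hmean : ∀ r ∈ Set.Ioo 0 s,
      ∫ θ in Set.Ioo (-π) π, (r : ℝ) • f (circleMap z r θ) = (r : ℝ) • (2 * π * f z) := by
    intro r hr
    have hav : Real.circleAverage f z r = f z := by
      refine DiffContOnCl.circleAverage (DifferentiableOn.diffContOnCl (hf.mono ?_))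
      rw [abs_of_pos hr.1]
      exact Metric.closure_ball_subset_closedBall.trans (Metric.closedBall_subset_closedBall hr.2.le)
    rw [Real.circleAverage_def, inv_smul_eq_iff₀ Real.two_pi_pos.ne'] at hav
    have hper : Function.Periodic (fun θ => f (circleMap z r θ)) (2 * π) :=
      fun θ => by simp only [periodic_circleMap z r θ]
    have := hper.intervalIntegral_add_eq (-π) 0
    rw [zero_add, hav, show -π + 2 * π = π by ring,
      intervalIntegral.integral_of_le (by linarith [pi_pos]), integral_Ioc_eq_integral_Ioo] at this
    rw [integral_smul, this]
    simp
  have hcont : ContinuousOn (fun p : ℝ × ℝ => p.1 • f (circleMap z p.1 p.2))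
      (Set.Icc 0 s ×ˢ Set.Icc (-π) π) := by
    refine continuousOn_fst.smul (hf.continuousOn.comp ?_ ?_)
    · simp only [circleMap]; fun_prop
    · rintro ⟨r, θ⟩ ⟨⟨hr0, hrs⟩, -⟩
      exact Metric.closedBall_subset_closedBall hrs (circleMap_mem_closedBall z hr0 θ)
  have hintg : IntegrableOn (fun p : ℝ × ℝ => p.1 • f (circleMap z p.1 p.2))
      (Set.Ioo 0 s ×ˢ Set.Ioo (-π) π) (volume.prod volume) :=
    (hcont.integrableOn_compact (isCompact_Icc.prod isCompact_Icc)).mono_set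
      (Set.prod_mono Set.Ioo_subset_Icc_self Set.Ioo_subset_Icc_self)
  calc ∫ x in Metric.ball z s, f x
      = ∫ x, (Metric.ball z s).indicator f (z + x) := by
        rw [integral_add_left_eq_self, integral_indicator measurableSet_ball]
    _ = ∫ p in polarCoord.target,
          p.1 • (Metric.ball z s).indicator f (circleMap z p.1 p.2) := by
        rw [← Complex.integral_comp_polarCoord_symm]
        simp_rw [hpolar]
    _ = ∫ p in polarCoord.target, (Set.Ioo 0 s ×ˢ Set.Ioo (-π) π).indicator
          (fun p : ℝ × ℝ => p.1 • f (circleMap z p.1 p.2)) p := by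
        refine setIntegral_congr_fun polarCoord.open_target.measurableSet ?_
        rintro ⟨r, θ⟩ ⟨hr, hθ⟩
        have hr' : 0 < r := hr
        by_cases h : r < s
        · have h1 : circleMap z r θ ∈ Metric.ball z s := by
            simpa [circleMap_sub_center, dist_eq_norm, abs_of_pos hr'] using h
          have h2 : (r, θ) ∈ Set.Ioo 0 s ×ˢ Set.Ioo (-π) π := ⟨⟨hr, h⟩, hθ⟩
          simp only [Set.indicator_of_mem h1, Set.indicator_of_mem h2]
        · have h1 : circleMap z r θ ∉ Metric.ball z s := by
            simpa [circleMap_sub_center, dist_eq_norm, abs_of_pos hr'] using h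
          have h2 : (r, θ) ∉ Set.Ioo 0 s ×ˢ Set.Ioo (-π) π := fun h' => h h'.1.2
          simp only [Set.indicator_of_notMem h1, Set.indicator_of_notMem h2, smul_zero]
    _ = ∫ p in Set.Ioo 0 s ×ˢ Set.Ioo (-π) π, p.1 • f (circleMap z p.1 p.2) := by
        rw [setIntegral_indicator (measurableSet_Ioo.prod measurableSet_Ioo)]
        congr 2
        exact Set.inter_eq_self_of_subset_right
          (Set.prod_mono Set.Ioo_subset_Ioi_self subset_rfl)
    _ = ∫ r in Set.Ioo 0 s, ∫ θ in Set.Ioo (-π) π, r • f (circleMap z r θ) :=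
        setIntegral_prod _ hintg
    _ = ∫ r in Set.Ioo 0 s, (r : ℝ) • (2 * π * f z) :=
        setIntegral_congr_fun measurableSet_Ioo hmean
    _ = ((π * s ^ 2 : ℝ) : ℂ) * f z := by
        rw [integral_smul_const, ← integral_Ioc_eq_integral_Ioo,
          ← intervalIntegral.integral_of_le hs, integral_id, Complex.real_smul]
        push_cast; ring

/-- The complex gradient of `y ↦ log (‖y + conj x‖ / ‖y - x‖)`. -/
def dipoleKernel (w x : ℂ) : ℂ := (w + starRingEnd ℂ x)⁻¹ - (w - x)⁻¹

theorem circleIntegral_inv_mul_inv {z x y : ℂ} {δ : ℝ} (hx : x ∈ Metric.ball z δ)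
    (hy : y ∈ Metric.ball z δ) :
    ∮ w in C(z, δ), (w - x)⁻¹ * (w - y)⁻¹ = 0 := by
  have hδ : 0 < δ := dist_nonneg.trans_lt hx
  have hne : ∀ {a : ℂ}, a ∈ Metric.ball z δ → ∀ w ∈ Metric.sphere z δ, w - a ≠ 0 := by
    intro a ha w hw h
    rw [sub_eq_zero] at h
    rw [h, Metric.mem_sphere] at hw
    exact (Metric.mem_ball.1 ha).ne hw
  have hi : ∀ {a : ℂ}, a ∈ Metric.ball z δ → CircleIntegrable (fun w => (w - a)⁻¹) z δ :=
    fun ha => ContinuousOn.circleIntegrable hδ.le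
      ((continuousOn_id.sub continuousOn_const).inv₀ (hne ha))
  by_cases hxy : x = y
  · subst hxy
    have := circleIntegral.integral_sub_zpow_of_ne (n := -2) (by norm_num) z x δ
    rw [← this]
    congr 1; ext w
    rw [zpow_neg, ← mul_inv]; norm_cast; rw [pow_two]
  · have hxy' : x - y ≠ 0 := sub_ne_zero.2 hxy
    have : ∮ w in C(z, δ), (w - x)⁻¹ * (w - y)⁻¹
        = ∮ w in C(z, δ), (x - y)⁻¹ * ((w - x)⁻¹ - (w - y)⁻¹) := by
      refine circleIntegral.integral_congr hδ.le fun w hw => ?_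
      have := hne hx w hw
      have := hne hy w hw
      field_simp
      ring
    rw [this, circleIntegral.integral_const_mul, circleIntegral.integral_sub (hi hx) (hi hy),
      circleIntegral.integral_sub_inv_of_mem_ball hx, circleIntegral.integral_sub_inv_of_mem_ball hy,
      sub_self, mul_zero]

theorem re_pos_of_mem_closedBall {z₁ δ : ℝ} (hz : δ < z₁) {x : ℂ}
    (hx : x ∈ Metric.closedBall (z₁ : ℂ) δ) : 0 < x.re := by
  have h1 : |(x - z₁).re| ≤ δ := (Complex.abs_re_le_norm _).trans (by
    rwa [Metric.mem_closedBall, dist_eq_norm] at hx)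
  rw [Complex.sub_re, Complex.ofReal_re] at h1
  linarith [(abs_le.1 h1).1]

theorem add_conj_ne_zero {x y : ℂ} (hx : 0 < x.re) (hy : 0 < y.re) :
    x + starRingEnd ℂ y ≠ 0 := fun h => by
  have := congrArg Complex.re h
  simp at this
  linarith

theorem circleIntegral_dipoleKernel_mul {z₁ δ : ℝ} (hz : δ < z₁) {x y : ℂ}
    (hx : x ∈ Metric.ball (z₁ : ℂ) δ) (hy : y ∈ Metric.ball (z₁ : ℂ) δ) :
    ∮ w in C(z₁, δ), dipoleKernel w x * dipoleKernel w y
      = -(2 * π * Complex.I) * (2 * ((x + starRingEnd ℂ y)⁻¹.re : ℂ)) := by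
  have hδ : 0 < δ := dist_nonneg.trans_lt hx
  have hre := fun {w : ℂ} (hw : w ∈ Metric.closedBall (z₁ : ℂ) δ) => re_pos_of_mem_closedBall hz hw
  have hH : ∀ {a : ℂ}, a ∈ Metric.ball (z₁ : ℂ) δ → DifferentiableOn ℂ
      (fun w => (w + starRingEnd ℂ a)⁻¹) (Metric.closedBall (z₁ : ℂ) δ) := by
    intro a ha
    exact (differentiableOn_id.add_const _).inv fun w hw =>
      add_conj_ne_zero (hre hw) (hre (Metric.ball_subset_closedBall ha))
  have hne : ∀ {a : ℂ}, a ∈ Metric.ball (z₁ : ℂ) δ → ∀ w ∈ Metric.sphere (z₁ : ℂ) δ,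
      w - a ≠ 0 := by
    intro a ha w hw h
    rw [sub_eq_zero] at h
    rw [h, Metric.mem_sphere] at hw
    exact (Metric.mem_ball.1 ha).ne hw
  have hi : ∀ {a : ℂ}, a ∈ Metric.ball (z₁ : ℂ) δ →
      ContinuousOn (fun w => (w - a)⁻¹) (Metric.sphere (z₁ : ℂ) δ) :=
    fun ha => (continuousOn_id.sub continuousOn_const).inv₀ (hne ha)
  have hc := fun {a : ℂ} (ha : a ∈ Metric.ball (z₁ : ℂ) δ) =>
    (hH ha).continuousOn.mono Metric.sphere_subset_closedBall
  have hexp : ∀ w, dipoleKernel w x * dipoleKernel w y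
      = (((w + starRingEnd ℂ x)⁻¹ * (w + starRingEnd ℂ y)⁻¹ + (w - x)⁻¹ * (w - y)⁻¹)
        - (w - y)⁻¹ • (w + starRingEnd ℂ x)⁻¹) - (w - x)⁻¹ • (w + starRingEnd ℂ y)⁻¹ := by
    intro w; simp only [dipoleKernel, smul_eq_mul]; ring
  have hHH : ∮ w in C(z₁, δ), (w + starRingEnd ℂ x)⁻¹ * (w + starRingEnd ℂ y)⁻¹ = 0 := by
    refine DiffContOnCl.circleIntegral_eq_zero hδ.le (DifferentiableOn.diffContOnCl ?_)
    exact ((hH hx).mul (hH hy)).mono Metric.closure_ball_subset_closedBall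
  simp_rw [hexp]
  have i1 : CircleIntegrable
      (fun w => (w + starRingEnd ℂ x)⁻¹ * (w + starRingEnd ℂ y)⁻¹) z₁ δ :=
    ((hc hx).mul (hc hy)).circleIntegrable hδ.le
  have i2 : CircleIntegrable (fun w => (w - x)⁻¹ * (w - y)⁻¹) z₁ δ :=
    ((hi hx).mul (hi hy)).circleIntegrable hδ.le
  have i12 : CircleIntegrable (fun w => (w + starRingEnd ℂ x)⁻¹ * (w + starRingEnd ℂ y)⁻¹
      + (w - x)⁻¹ * (w - y)⁻¹) z₁ δ := i1.add i2
  have i3 : CircleIntegrable (fun w => (w - y)⁻¹ • (w + starRingEnd ℂ x)⁻¹) z₁ δ :=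
    ((hi hy).smul (hc hx)).circleIntegrable hδ.le
  have i123 : CircleIntegrable (fun w => (w + starRingEnd ℂ x)⁻¹ * (w + starRingEnd ℂ y)⁻¹
      + (w - x)⁻¹ * (w - y)⁻¹ - (w - y)⁻¹ • (w + starRingEnd ℂ x)⁻¹) z₁ δ := i12.sub i3
  have i4 : CircleIntegrable (fun w => (w - x)⁻¹ • (w + starRingEnd ℂ y)⁻¹) z₁ δ :=
    ((hi hx).smul (hc hy)).circleIntegrable hδ.le
  rw [circleIntegral.integral_sub i123 i4, circleIntegral.integral_sub i12 i3,
    circleIntegral.integral_add i1 i2, hHH, circleIntegral_inv_mul_inv hx hy,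
    (hH hx).circleIntegral_sub_inv_smul hy, (hH hy).circleIntegral_sub_inv_smul hx]
  have hconj : (y + starRingEnd ℂ x)⁻¹ = starRingEnd ℂ ((x + starRingEnd ℂ y)⁻¹) := by
    rw [map_inv₀, map_add, Complex.conj_conj, add_comm]
  have hre2 := Complex.add_conj (x + starRingEnd ℂ y)⁻¹
  rw [hconj]
  simp only [smul_eq_mul]
  push_cast at hre2
  linear_combination -(2 * π * Complex.I) * hre2

theorem quarter_le_norm_sub_and_norm_add_conj {z₁ δ : ℝ} (hz : 2 * δ ≤ z₁) {x y : ℂ}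
    (hx : x ∈ Metric.closedBall (z₁ : ℂ) (δ / 2)) (hy : 3 / 4 * δ ≤ dist y z₁)
    (hy' : dist y z₁ ≤ 5 / 4 * δ) :
    δ / 4 ≤ ‖y - x‖ ∧ δ / 4 ≤ ‖y + starRingEnd ℂ x‖ := by
  rw [Metric.mem_closedBall] at hx
  constructor
  · have := dist_triangle y x z₁
    rw [← dist_eq_norm]; linarith
  · have h1 : |(x - z₁).re| ≤ δ / 2 := (Complex.abs_re_le_norm _).trans (by rwa [← dist_eq_norm])
    have h2 : |(y - z₁).re| ≤ 5 / 4 * δ :=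
      (Complex.abs_re_le_norm _).trans (by rwa [← dist_eq_norm])
    have h3 := Complex.re_le_norm (y + starRingEnd ℂ x)
    simp only [Complex.sub_re, Complex.ofReal_re, Complex.add_re, Complex.conj_re] at h1 h2 h3
    linarith [(abs_le.1 h1).1, (abs_le.1 h2).1]

theorem norm_dipoleKernel_le {z₁ δ : ℝ} (hδ : 0 < δ) (hz : 2 * δ ≤ z₁) {x y : ℂ}
    (hx : x ∈ Metric.closedBall (z₁ : ℂ) (δ / 2)) (hy : 3 / 4 * δ ≤ dist y z₁)
    (hy' : dist y z₁ ≤ 5 / 4 * δ) :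
    ‖dipoleKernel y x‖ ≤ 8 / δ := by
  obtain ⟨h1, h2⟩ := quarter_le_norm_sub_and_norm_add_conj hz hx hy hy'
  have h4 : 0 < δ / 4 := by positivity
  calc ‖dipoleKernel y x‖ ≤ ‖(y + starRingEnd ℂ x)⁻¹‖ + ‖(y - x)⁻¹‖ := norm_sub_le _ _
    _ ≤ (δ / 4)⁻¹ + (δ / 4)⁻¹ := by
      rw [norm_inv, norm_inv]; gcongr
    _ = 8 / δ := by field_simp; norm_num

@[fun_prop]
theorem measurable_dipoleKernel : Measurable fun p : ℂ × ℂ => dipoleKernel p.1 p.2 := by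
  have : Measurable (starRingEnd ℂ : ℂ → ℂ) := Complex.continuous_conj.measurable
  unfold dipoleKernel
  fun_prop

/-- The complex velocity `w ↦ ∫_A dipoleKernel w x dx`. -/
def dipoleField (A : Set ℂ) (w : ℂ) : ℂ := ∫ x in A, dipoleKernel w x

theorem measurable_dipoleField (A : Set ℂ) : Measurable (dipoleField A) :=
  (measurable_dipoleKernel.stronglyMeasurable.integral_prod_right
    (ν := volume.restrict A)).measurable

theorem isFiniteMeasure_restrict_of_subset_ball {X : Type*} [MeasureSpace X] [PseudoMetricSpace X]
    [ProperSpace X] [IsFiniteMeasureOnCompacts (volume : Measure X)] {A : Set X} {z : X} {r : ℝ}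
    (h : A ⊆ Metric.ball z r) : IsFiniteMeasure (volume.restrict A) :=
  ⟨by rw [Measure.restrict_apply_univ]; exact (measure_mono h).trans_lt measure_ball_lt_top⟩

theorem norm_dipoleField_le {z₁ δ : ℝ} (hδ : 0 < δ) (hz : 2 * δ ≤ z₁) {A : Set ℂ}
    (hAz : A ⊆ Metric.ball (z₁ : ℂ) (δ / 2)) {w : ℂ} (hw : w ∈ Metric.sphere (z₁ : ℂ) δ) :
    ‖dipoleField A w‖ ≤ 8 / δ * volume.real A := by
  have := isFiniteMeasure_restrict_of_subset_ball hAz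
  refine norm_setIntegral_le_of_norm_le_const ?_ fun x hx => ?_
  · exact (measure_mono hAz).trans_lt measure_ball_lt_top
  · rw [Metric.mem_sphere] at hw
    exact norm_dipoleKernel_le hδ hz (Metric.ball_subset_closedBall (hAz hx)) (by linarith)
      (by linarith)

/-- The kernel of the interaction with the mirror image, `Re (1 / (x + conj y))`. -/
def mirrorKernel (x y : ℂ) : ℝ := (x + starRingEnd ℂ y)⁻¹.re

theorem integral_circleMap_mul_dipoleField_sq {z₁ δ : ℝ} (hδ : 0 < δ) (hz : 2 * δ ≤ z₁)
    {A : Set ℂ} (hA : MeasurableSet A) (hAz : A ⊆ Metric.ball (z₁ : ℂ) (δ / 2)) :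
    ∫ θ in (0)..(2 * π), circleMap 0 δ θ * dipoleField A (circleMap z₁ δ θ) ^ 2
      = ((-(4 * π) * ∫ p in A ×ˢ A, mirrorKernel p.1 p.2 ∂(volume.prod volume) : ℝ) : ℂ) := by
  have := isFiniteMeasure_restrict_of_subset_ball hAz
  have hsub : A ⊆ Metric.ball (z₁ : ℂ) δ :=
    hAz.trans (Metric.ball_subset_ball (by linarith))
  have hsq : ∀ θ, circleMap 0 δ θ * dipoleField A (circleMap z₁ δ θ) ^ 2
      = ∫ p in A ×ˢ A, circleMap 0 δ θ * (dipoleKernel (circleMap z₁ δ θ) p.1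
        * dipoleKernel (circleMap z₁ δ θ) p.2) ∂(volume.prod volume) := by
    intro θ
    rw [integral_const_mul, ← Measure.prod_restrict, integral_prod_mul, ← pow_two]
    rfl
  have hintg : Integrable (Function.uncurry fun (θ : ℝ) (p : ℂ × ℂ) =>
      circleMap 0 δ θ * (dipoleKernel (circleMap z₁ δ θ) p.1
        * dipoleKernel (circleMap z₁ δ θ) p.2))
      ((volume.restrict (Set.Ioc 0 (2 * π))).prod
        ((volume.prod volume).restrict (A ×ˢ A))) := by
    have : IsFiniteMeasure (((volume : Measure ℂ).prod (volume : Measure ℂ)).restrict (A ×ˢ A)) := by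
      rw [← Measure.prod_restrict]; infer_instance
    refine Integrable.of_bound (C := δ * (8 / δ * (8 / δ))) ?_ ?_
    · refine Measurable.aestronglyMeasurable ?_
      have := measurable_circleMap 0 δ
      have := measurable_circleMap z₁ δ
      have h1 : Measurable fun q : ℝ × ℂ × ℂ => dipoleKernel (circleMap z₁ δ q.1) q.2.1 :=
        measurable_dipoleKernel.comp
          (f := fun q : ℝ × ℂ × ℂ => (circleMap z₁ δ q.1, q.2.1)) (by fun_prop)
      have h2 : Measurable fun q : ℝ × ℂ × ℂ => dipoleKernel (circleMap z₁ δ q.1) q.2.2 :=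
        measurable_dipoleKernel.comp
          (f := fun q : ℝ × ℂ × ℂ => (circleMap z₁ δ q.1, q.2.2)) (by fun_prop)
      unfold Function.uncurry
      fun_prop
    · rw [Measure.prod_restrict]
      refine ae_restrict_of_forall_mem (measurableSet_Ioc.prod (hA.prod hA)) ?_
      rintro ⟨θ, x, y⟩ ⟨-, hx, hy⟩
      have hd : dist (circleMap (z₁ : ℂ) δ θ) z₁ = δ := circleMap_mem_sphere _ hδ.le θ
      have hK : ∀ x ∈ A, ‖dipoleKernel (circleMap z₁ δ θ) x‖ ≤ 8 / δ := fun x hx =>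
        norm_dipoleKernel_le hδ hz (Metric.ball_subset_closedBall (hAz hx)) (by linarith)
          (by linarith)
      have h0 : ‖circleMap 0 δ θ‖ = δ := by rw [norm_circleMap_zero, abs_of_pos hδ]
      simp only [Function.uncurry, norm_mul, h0]
      gcongr
      · exact hK x hx
      · exact hK y hy
  have hinner : ∀ p ∈ A ×ˢ A, ∫ θ in Set.Ioc 0 (2 * π),
      circleMap 0 δ θ * (dipoleKernel (circleMap z₁ δ θ) p.1
        * dipoleKernel (circleMap z₁ δ θ) p.2)
      = ((-(4 * π) * mirrorKernel p.1 p.2 : ℝ) : ℂ) := by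
    rintro ⟨x, y⟩ ⟨hx, hy⟩
    have h := circleIntegral_dipoleKernel_mul (by linarith : δ < z₁) (hsub hx) (hsub hy)
    rw [circleIntegral_def_Icc, integral_Icc_eq_integral_Ioc] at h
    have h' : ∀ θ, deriv (circleMap (z₁ : ℂ) δ) θ • (dipoleKernel (circleMap z₁ δ θ) x
        * dipoleKernel (circleMap z₁ δ θ) y) = Complex.I * (circleMap 0 δ θ *
          (dipoleKernel (circleMap z₁ δ θ) x * dipoleKernel (circleMap z₁ δ θ) y)) := by
      intro θ; rw [deriv_circleMap, smul_eq_mul]; ring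
    simp_rw [h', integral_const_mul] at h
    have := mul_left_cancel₀ Complex.I_ne_zero (h.trans (b := _) (c := Complex.I *
      ((-(4 * π) * mirrorKernel x y : ℝ) : ℂ)) (by
        simp only [mirrorKernel]; push_cast; ring))
    exact this
  rw [intervalIntegral.integral_of_le Real.two_pi_pos.le]
  simp_rw [hsq]
  rw [integral_integral_swap hintg, setIntegral_congr_fun (hA.prod hA) hinner]
  exact integral_ofReal.trans (congrArg _ (integral_const_mul _ _))

/-- The boundary Pohozaev integral, evaluated for the potential of a set `A` and its mirror image. -/
theorem boundary_integral_eq_mirrorKernel {z₁ δ : ℝ} (hδ : 0 < δ) (hz : 2 * δ ≤ z₁)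
    {A : Set ℂ} (hA : MeasurableSet A) (hAz : A ⊆ Metric.ball (z₁ : ℂ) (δ / 2)) (c : ℝ)
    {G : ℂ → ℂ} (hG : ∀ w ∈ Metric.sphere (z₁ : ℂ) δ, G w = c * starRingEnd ℂ (dipoleField A w)) :
    -(∫ w in Metric.sphere (z₁ : ℂ) δ, (⟪G w, w - z₁⟫ / δ) * (G w).re ∂μH[1])
      + (1 / 2) * (∫ w in Metric.sphere (z₁ : ℂ) δ, ‖G w‖ ^ 2 * ((w.re - z₁) / δ) ∂μH[1])
      = 2 * π * c ^ 2 * ∫ p in A ×ˢ A, mirrorKernel p.1 p.2 ∂(volume.prod volume) := by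
  set G' : ℂ → ℂ := fun w => c * starRingEnd ℂ (dipoleField A w) with hG'
  have mf := measurable_dipoleField A
  have mc : Measurable (starRingEnd ℂ : ℂ → ℂ) := Complex.continuous_conj.measurable
  have mG : Measurable G' := by fun_prop
  have hm := measurable_circleMap z₁ δ
  have bf : ∀ θ, ‖dipoleField A (circleMap z₁ δ θ)‖ ≤ 8 / δ * volume.real A := fun θ =>
    norm_dipoleField_le hδ hz hAz (circleMap_mem_sphere _ hδ.le θ)
  set M : ℝ := |c| * (8 / δ * volume.real A) with hM
  have bG : ∀ θ, ‖G' (circleMap z₁ δ θ)‖ ≤ M := fun θ => by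
    rw [hG', norm_mul, RCLike.norm_conj, Complex.norm_real, Real.norm_eq_abs]
    exact mul_le_mul_of_nonneg_left (bf θ) (abs_nonneg c)
  have hM0 : 0 ≤ M := by positivity
  have hd : ∀ θ, ‖circleMap (z₁ : ℂ) δ θ - z₁‖ = δ := fun θ => by
    simp [abs_of_pos hδ]
  have m1 : Measurable fun w : ℂ => (⟪G' w, w - z₁⟫ / δ) * (G' w).re := by
    have : Measurable fun w : ℂ => ⟪G' w, w - z₁⟫ := mG.inner (by fun_prop)
    exact (this.div_const δ).mul (Complex.measurable_re.comp mG)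
  have m2 : Measurable fun w : ℂ => ‖G' w‖ ^ 2 * ((w.re - z₁) / δ) :=
    (mG.norm.pow_const 2).mul ((Complex.measurable_re.sub_const z₁).div_const δ)
  have e1 : ∫ w in Metric.sphere (z₁ : ℂ) δ, (⟪G w, w - z₁⟫ / δ) * (G w).re ∂μH[1]
      = ∫ w in Metric.sphere (z₁ : ℂ) δ, (⟪G' w, w - z₁⟫ / δ) * (G' w).re ∂μH[1] :=
    setIntegral_congr_fun Metric.isClosed_sphere.measurableSet fun w hw => by
      simp only [hG w hw, hG']
  have e2 : ∫ w in Metric.sphere (z₁ : ℂ) δ, ‖G w‖ ^ 2 * ((w.re - z₁) / δ) ∂μH[1]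
      = ∫ w in Metric.sphere (z₁ : ℂ) δ, ‖G' w‖ ^ 2 * ((w.re - z₁) / δ) ∂μH[1] :=
    setIntegral_congr_fun Metric.isClosed_sphere.measurableSet fun w hw => by
      simp only [hG w hw, hG']
  have i1 : IntervalIntegrable (fun θ => (⟪G' (circleMap z₁ δ θ), circleMap z₁ δ θ - z₁⟫ / δ)
      * (G' (circleMap z₁ δ θ)).re) volume 0 (2 * π) := by
    rw [intervalIntegrable_iff_integrableOn_Ioc_of_le Real.two_pi_pos.le]
    refine Integrable.of_bound (C := M * M) (m1.comp hm).aestronglyMeasurable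
      (Eventually.of_forall fun θ => ?_)
    rw [norm_mul, norm_div, Real.norm_of_nonneg hδ.le]
    gcongr
    · rw [div_le_iff₀ hδ]
      refine (norm_inner_le_norm _ _).trans ?_
      rw [hd]
      exact mul_le_mul_of_nonneg_right (bG θ) hδ.le
    · exact (Complex.abs_re_le_norm _).trans (bG θ)
  have i2 : IntervalIntegrable (fun θ => ‖G' (circleMap z₁ δ θ)‖ ^ 2
      * (((circleMap z₁ δ θ).re - z₁) / δ)) volume 0 (2 * π) := by
    rw [intervalIntegrable_iff_integrableOn_Ioc_of_le Real.two_pi_pos.le]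
    refine Integrable.of_bound (C := M ^ 2 * 1) (m2.comp hm).aestronglyMeasurable
      (Eventually.of_forall fun θ => ?_)
    rw [norm_mul, norm_div, Real.norm_of_nonneg hδ.le, norm_pow, norm_norm]
    gcongr
    · exact bG θ
    · rw [div_le_one hδ]
      have := Complex.abs_re_le_norm (circleMap z₁ δ θ - z₁)
      rwa [hd, Complex.sub_re, Complex.ofReal_re] at this
  have i3 : IntervalIntegrable
      (fun θ => circleMap 0 δ θ * dipoleField A (circleMap z₁ δ θ) ^ 2) volume 0 (2 * π) := by
    rw [intervalIntegrable_iff_integrableOn_Ioc_of_le Real.two_pi_pos.le]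
    refine Integrable.of_bound (C := δ * (8 / δ * volume.real A) ^ 2)
      (Measurable.aestronglyMeasurable ?_) (Eventually.of_forall fun θ => ?_)
    · have := measurable_circleMap 0 δ
      fun_prop
    · rw [norm_mul, norm_pow, norm_circleMap_zero, abs_of_pos hδ]
      gcongr
      exact bf θ
  have hpt : ∀ θ, -((⟪G' (circleMap z₁ δ θ), circleMap z₁ δ θ - z₁⟫ / δ)
        * (G' (circleMap z₁ δ θ)).re)
      + 1 / 2 * (‖G' (circleMap z₁ δ θ)‖ ^ 2 * (((circleMap z₁ δ θ).re - z₁) / δ))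
      = -(c ^ 2 / (2 * δ)) * (circleMap 0 δ θ * dipoleField A (circleMap z₁ δ θ) ^ 2).re := by
    intro θ
    have h1 : circleMap (z₁ : ℂ) δ θ - z₁ = circleMap 0 δ θ := circleMap_sub_center _ _ _
    have h2 : (circleMap (z₁ : ℂ) δ θ).re - z₁ = (circleMap 0 δ θ).re := by
      rw [← h1, Complex.sub_re, Complex.ofReal_re]
    rw [h1, h2, Complex.inner, ← Complex.normSq_eq_norm_sq, Complex.normSq_apply]
    simp only [hG', pow_two, Complex.mul_re, Complex.mul_im, Complex.conj_re, Complex.conj_im,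
      Complex.ofReal_re, Complex.ofReal_im]
    field_simp
    ring
  have hJ := congrArg Complex.re (integral_circleMap_mul_dipoleField_sq hδ hz hA hAz)
  rw [Complex.ofReal_re] at hJ
  have hre : ∫ θ in (0)..(2 * π), (circleMap 0 δ θ * dipoleField A (circleMap z₁ δ θ) ^ 2).re
      = (∫ θ in (0)..(2 * π), circleMap 0 δ θ * dipoleField A (circleMap z₁ δ θ) ^ 2).re := by
    exact Complex.reCLM.intervalIntegral_comp_comm i3
  rw [e1, e2, setIntegral_sphere_hausdorffMeasure _ hδ m1, setIntegral_sphere_hausdorffMeasure _ hδ m2]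
  have hsum := intervalIntegral.integral_add i1.neg (i2.const_mul (1 / 2))
  simp only [Pi.neg_apply] at hsum
  simp_rw [hpt, intervalIntegral.integral_const_mul, intervalIntegral.integral_neg, hre, hJ] at hsum
  have : δ * δ⁻¹ = 1 := mul_inv_cancel₀ hδ.ne'
  linear_combination (-δ) * hsum
    + (2 * π * c ^ 2 * ∫ p in A ×ˢ A, mirrorKernel p.1 p.2 ∂(volume.prod volume)) * this

theorem hasGradientAt_log_norm_sub {y a : ℂ} (h : y ≠ a) :
    HasGradientAt (fun y : ℂ => Real.log ‖y - a‖) (starRingEnd ℂ (y - a)⁻¹) y := by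
  have h0 : ‖y - a‖ ≠ 0 := norm_ne_zero_iff.2 (sub_ne_zero.2 h)
  have h1 := ((((hasFDerivAt_id (𝕜 := ℝ) y).sub_const a).norm_sq).log (pow_ne_zero 2 h0)).const_mul
    (1 / 2 : ℝ)
  rw [hasGradientAt_iff_hasFDerivAt]
  refine (h1.congr_of_eventuallyEq (Eventually.of_forall fun w => ?_)).congr_fderiv
    (ContinuousLinearMap.ext fun v => ?_)
  · simp [Real.log_pow]
  · have hinv : starRingEnd ℂ (y - a)⁻¹ = ((‖y - a‖ ^ 2)⁻¹ : ℝ) • (y - a) := by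
      rw [Complex.inv_def, map_mul, Complex.conj_conj, Complex.conj_ofReal,
        Complex.normSq_eq_norm_sq, Complex.real_smul, mul_comm]
    rw [InnerProductSpace.toDual_apply_apply, hinv, real_inner_smul_left]
    simp only [smul_apply, ContinuousLinearMap.comp_apply, innerSL_apply_apply, smul_eq_mul,
      ContinuousLinearMap.id_apply, id]
    ring

theorem hasGradientAt_integral_log {z₁ δ : ℝ} (hδ : 0 < δ) (hz : 2 * δ ≤ z₁)
    {A : Set ℂ} (hA : MeasurableSet A) (hAz : A ⊆ Metric.ball (z₁ : ℂ) (δ / 2)) (c : ℝ) {w : ℂ}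
    (hw : w ∈ Metric.sphere (z₁ : ℂ) δ) :
    HasGradientAt (fun y : ℂ => c * ∫ x in A, Real.log (‖y + starRingEnd ℂ x‖ / ‖y - x‖))
      (c * starRingEnd ℂ (dipoleField A w)) w := by
  have hfin := isFiniteMeasure_restrict_of_subset_ball hAz
  have hcl : ∀ x ∈ A, x ∈ Metric.closedBall (z₁ : ℂ) (δ / 2) := fun x hx =>
    Metric.ball_subset_closedBall (hAz hx)
  have mc : Measurable (starRingEnd ℂ : ℂ → ℂ) := Complex.continuous_conj.measurable
  have hdist : ∀ y ∈ Metric.ball w (δ / 4), 3 / 4 * δ ≤ dist y z₁ ∧ dist y z₁ ≤ 5 / 4 * δ := by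
    intro y hy
    rw [Metric.mem_ball] at hy
    rw [Metric.mem_sphere] at hw
    have h1 := dist_triangle w y z₁
    have h2 := dist_triangle y w z₁
    rw [dist_comm w y] at h1
    constructor <;> linarith
  have hpos : ∀ x ∈ Metric.closedBall (z₁ : ℂ) (δ / 2), ∀ y ∈ Metric.ball w (δ / 4),
      0 < ‖y - x‖ ∧ 0 < ‖y + starRingEnd ℂ x‖ := by
    intro x hx y hy
    obtain ⟨h1, h2⟩ :=
      quarter_le_norm_sub_and_norm_add_conj hz hx (hdist y hy).1 (hdist y hy).2
    exact ⟨by linarith, by linarith⟩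
  have hgrad : ∀ x ∈ A, ∀ y ∈ Metric.ball w (δ / 4),
      HasFDerivAt (fun y : ℂ => Real.log (‖y + starRingEnd ℂ x‖ / ‖y - x‖))
        (InnerProductSpace.toDual ℝ ℂ (starRingEnd ℂ (dipoleKernel y x))) y := by
    intro x hx y hy
    obtain ⟨p1, p2⟩ := hpos x (hcl x hx) y hy
    have g1 := (hasGradientAt_log_norm_sub (y := y) (a := -starRingEnd ℂ x) (by
      rintro rfl; simp at p2)).hasFDerivAt
    have g2 := (hasGradientAt_log_norm_sub (y := y) (a := x) (by
      rintro rfl; simp at p1)).hasFDerivAt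
    have g := g1.sub g2
    rw [← map_sub, ← map_sub, sub_neg_eq_add] at g
    refine g.congr_of_eventuallyEq ?_
    filter_upwards [Metric.isOpen_ball.mem_nhds hy] with u hu
    obtain ⟨q1, q2⟩ := hpos x (hcl x hx) u hu
    rw [Real.log_div q2.ne' q1.ne', Pi.sub_apply, sub_neg_eq_add]
  have hwball : w ∈ Metric.ball w (δ / 4) := Metric.mem_ball_self (by positivity)
  have mK : Measurable fun x => starRingEnd ℂ (dipoleKernel w x) :=
    mc.comp (measurable_dipoleKernel.comp (f := fun x : ℂ => (w, x)) (by fun_prop))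
  have mF' : AEStronglyMeasurable
      (fun x => InnerProductSpace.toDual ℝ ℂ (starRingEnd ℂ (dipoleKernel w x)))
      (volume.restrict A) :=
    (InnerProductSpace.toDual ℝ ℂ).continuous.comp_aestronglyMeasurable mK.aestronglyMeasurable
  have hbound : ∀ x ∈ A, ∀ y ∈ Metric.ball w (δ / 4),
      ‖InnerProductSpace.toDual ℝ ℂ (starRingEnd ℂ (dipoleKernel y x))‖ ≤ 8 / δ := by
    intro x hx y hy
    rw [LinearIsometryEquiv.norm_map, RCLike.norm_conj]
    exact norm_dipoleKernel_le hδ hz (hcl x hx) (hdist y hy).1 (hdist y hy).2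
  have hF := hasFDerivAt_integral_of_dominated_of_fderiv_le (μ := volume.restrict A)
    (F := fun (y x : ℂ) => Real.log (‖y + starRingEnd ℂ x‖ / ‖y - x‖))
    (F' := fun y x => InnerProductSpace.toDual ℝ ℂ (starRingEnd ℂ (dipoleKernel y x)))
    (bound := fun _ => 8 / δ) (Metric.ball_mem_nhds w (by positivity : 0 < δ / 4))
    (Eventually.of_forall fun y => Measurable.aestronglyMeasurable (by fun_prop))
    (by
      refine IntegrableOn.mono_set (ContinuousOn.integrableOn_compact
        (isCompact_closedBall (z₁ : ℂ) (δ / 2)) ?_) hcl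
      have := Complex.continuous_conj
      refine ContinuousOn.log (ContinuousOn.div (by fun_prop) (by fun_prop) ?_) ?_
      · exact fun x hx => (hpos x hx w hwball).1.ne'
      · exact fun x hx => (div_pos (hpos x hx w hwball).2 (hpos x hx w hwball).1).ne')
    mF'
    (ae_restrict_of_forall_mem hA hbound)
    (integrable_const _)
    (ae_restrict_of_forall_mem hA hgrad)
  have hintg : Integrable (fun x => InnerProductSpace.toDual ℝ ℂ (starRingEnd ℂ (dipoleKernel w x)))
      (volume.restrict A) :=
    Integrable.of_bound mF' (8 / δ)
      (ae_restrict_of_forall_mem hA fun x hx => hbound x hx w hwball)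
  have hintg' : Integrable (fun x => starRingEnd ℂ (dipoleKernel w x)) (volume.restrict A) :=
    Integrable.of_bound mK.aestronglyMeasurable (8 / δ)
      (ae_restrict_of_forall_mem hA fun x hx => by
        simpa [LinearIsometryEquiv.norm_map] using hbound x hx w hwball)
  rw [hasGradientAt_iff_hasFDerivAt]
  refine (hF.const_mul c).congr_fderiv (ContinuousLinearMap.ext fun v => ?_)
  rw [smul_apply, ContinuousLinearMap.integral_apply hintg, InnerProductSpace.toDual_apply_apply,
    ← Complex.real_smul, real_inner_smul_left, smul_eq_mul, dipoleField, ← integral_conj]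
  congr 1
  rw [real_inner_comm, ← integral_inner hintg' v]
  simp only [InnerProductSpace.toDual_apply_apply, real_inner_comm]

/-- Integrals of a bounded function over two sets differ by at most the bound times the measure
of the symmetric difference. -/
theorem abs_setIntegral_sub_setIntegral_le {α : Type*} [MeasurableSpace α] {μ : Measure α}
    {A B : Set α} (hA : MeasurableSet A) (hB : MeasurableSet B) (hμA : μ A ≠ ⊤) (hμB : μ B ≠ ⊤)
    {u : α → ℝ} {M : ℝ} (huA : IntegrableOn u A μ) (huB : IntegrableOn u B μ)
    (hM : ∀ x ∈ A ∪ B, |u x| ≤ M) :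
    |(∫ x in A, u x ∂μ) - ∫ x in B, u x ∂μ| ≤ M * μ.real (symmDiff A B) := by
  have hAB : μ (A \ B) < ⊤ := (measure_mono Set.sdiff_subset).trans_lt hμA.lt_top
  have hBA : μ (B \ A) < ⊤ := (measure_mono Set.sdiff_subset).trans_lt hμB.lt_top
  have h₁ := integral_inter_add_sdiff hB huA
  have h₂ := integral_inter_add_sdiff hA huB
  rw [Set.inter_comm] at h₂
  have h₃ : ‖∫ x in A \ B, u x ∂μ‖ ≤ M * μ.real (A \ B) :=
    norm_setIntegral_le_of_norm_le_const hAB fun x hx => hM x (Or.inl hx.1)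
  have h₄ : ‖∫ x in B \ A, u x ∂μ‖ ≤ M * μ.real (B \ A) :=
    norm_setIntegral_le_of_norm_le_const hBA fun x hx => hM x (Or.inr hx.1)
  have h₅ : μ.real (symmDiff A B) = μ.real (A \ B) + μ.real (B \ A) :=
    measureReal_union disjoint_sdiff_sdiff (hB.diff hA) hAB.ne hBA.ne
  rw [h₅, ← h₁, ← h₂, add_sub_add_left_eq_sub, mul_add]
  exact (abs_sub _ _).trans (add_le_add h₃ h₄)

theorem mirrorKernel_comm (x y : ℂ) : mirrorKernel x y = mirrorKernel y x := by
  have : (y + starRingEnd ℂ x)⁻¹ = starRingEnd ℂ ((x + starRingEnd ℂ y)⁻¹) := by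
    simp [map_inv₀, add_comm]
  rw [mirrorKernel, mirrorKernel, this, Complex.conj_re]

theorem measurable_mirrorKernel : Measurable fun p : ℂ × ℂ => mirrorKernel p.1 p.2 := by
  unfold mirrorKernel
  have h : Measurable fun p : ℂ × ℂ => p.1 + starRingEnd ℂ p.2 := by fun_prop
  exact Complex.measurable_re.comp h.inv

theorem le_norm_add_conj {x y : ℂ} {d : ℝ} (hx : d / 2 ≤ x.re) (hy : d / 2 ≤ y.re) :
    d ≤ ‖x + starRingEnd ℂ y‖ := by
  refine le_trans ?_ (Complex.re_le_norm _)
  simp; linarith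

theorem abs_mirrorKernel_le {x y : ℂ} {d : ℝ} (hd : 0 < d) (hx : d / 2 ≤ x.re)
    (hy : d / 2 ≤ y.re) : |mirrorKernel x y| ≤ 1 / d := by
  refine (Complex.abs_re_le_norm _).trans ?_
  rw [norm_inv, ← one_div]
  exact one_div_le_one_div_of_le hd (le_norm_add_conj hx hy)

theorem abs_mirrorKernel_sub_le {x x' y : ℂ} {d : ℝ} (hd : 0 < d) (hx : d / 2 ≤ x.re)
    (hx' : d / 2 ≤ x'.re) (hy : d / 2 ≤ y.re) :
    |mirrorKernel x y - mirrorKernel x' y| ≤ ‖x - x'‖ / d ^ 2 := by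
  have h₁ := le_norm_add_conj hx hy
  have h₂ := le_norm_add_conj hx' hy
  have n₁ : x + starRingEnd ℂ y ≠ 0 := norm_pos_iff.1 (hd.trans_le h₁)
  have n₂ : x' + starRingEnd ℂ y ≠ 0 := norm_pos_iff.1 (hd.trans_le h₂)
  unfold mirrorKernel
  rw [← Complex.sub_re]
  refine (Complex.abs_re_le_norm _).trans ?_
  rw [inv_sub_inv n₁ n₂, norm_div, norm_mul, add_sub_add_right_eq_sub, norm_sub_rev, sq]
  gcongr

theorem half_le_re_of_mem_ball {z₁ ρ d : ℝ} (hd : d ≤ z₁) (hρ : 2 * ρ ≤ d) {x : ℂ}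
    (hx : x ∈ Metric.ball (z₁ : ℂ) ρ) : d / 2 ≤ x.re := by
  have h := (Complex.abs_re_le_norm (x - z₁)).trans_lt (mem_ball_iff_norm.1 hx)
  simp only [Complex.sub_re, Complex.ofReal_re] at h
  linarith [(abs_lt.1 h).1]

section Estimate

variable {z₁ ρ d : ℝ}

theorem integrableOn_mirrorKernel_prod (hd₀ : 0 < d) (hd : d ≤ z₁) (hρ : 2 * ρ ≤ d)
    {S T : Set ℂ} (hS : MeasurableSet S) (hT : MeasurableSet T)
    (hSz : S ⊆ Metric.ball (z₁ : ℂ) ρ) (hTz : T ⊆ Metric.ball (z₁ : ℂ) ρ) :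
    IntegrableOn (fun p : ℂ × ℂ => mirrorKernel p.1 p.2) (S ×ˢ T) (volume.prod volume) := by
  have hSf : volume S < ⊤ := (measure_mono hSz).trans_lt measure_ball_lt_top
  have hTf : volume T < ⊤ := (measure_mono hTz).trans_lt measure_ball_lt_top
  refine Measure.integrableOn_of_bounded (M := 1 / d) ?_
    measurable_mirrorKernel.aestronglyMeasurable ?_
  · rw [Measure.prod_prod]
    exact (ENNReal.mul_lt_top hSf hTf).ne
  · refine (ae_restrict_iff' (hS.prod hT)).2 (Eventually.of_forall fun p hp => ?_)
    exact abs_mirrorKernel_le hd₀ (half_le_re_of_mem_ball hd hρ (hSz hp.1))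
      (half_le_re_of_mem_ball hd hρ (hTz hp.2))

theorem integrableOn_mirrorKernel (hd₀ : 0 < d) (hd : d ≤ z₁) (hρ : 2 * ρ ≤ d)
    {S : Set ℂ} (hS : MeasurableSet S) (hSz : S ⊆ Metric.ball (z₁ : ℂ) ρ) {x : ℂ}
    (hx : d / 2 ≤ x.re) : IntegrableOn (mirrorKernel x) S := by
  refine Measure.integrableOn_of_bounded (M := 1 / d)
    ((measure_mono hSz).trans_lt measure_ball_lt_top).ne
    (measurable_mirrorKernel.comp measurable_prodMk_left).aestronglyMeasurable ?_
  refine (ae_restrict_iff' hS).2 (Eventually.of_forall fun y hy => ?_)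
  exact abs_mirrorKernel_le hd₀ hx (half_le_re_of_mem_ball hd hρ (hSz hy))

theorem integrableOn_integral_mirrorKernel (hd₀ : 0 < d) (hd : d ≤ z₁) (hρ : 2 * ρ ≤ d)
    {S T : Set ℂ} (hS : MeasurableSet S) (hT : MeasurableSet T)
    (hSz : S ⊆ Metric.ball (z₁ : ℂ) ρ) (hTz : T ⊆ Metric.ball (z₁ : ℂ) ρ) :
    IntegrableOn (fun x => ∫ y in S, mirrorKernel x y) T := by
  have h := integrableOn_mirrorKernel_prod hd₀ hd hρ hT hS hTz hSz
  rw [IntegrableOn, ← Measure.prod_restrict] at h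
  exact h.integral_prod_left

theorem abs_setIntegral_mirrorKernel_sub_le (hd₀ : 0 < d) (hd : d ≤ z₁) (hρ₀ : 0 < ρ)
    (hρ : 2 * ρ ≤ d) {A B S : Set ℂ} (hA : MeasurableSet A) (hB : MeasurableSet B)
    (hS : MeasurableSet S) (hAz : A ⊆ Metric.ball (z₁ : ℂ) ρ) (hBz : B ⊆ Metric.ball (z₁ : ℂ) ρ)
    (hSz : S ⊆ Metric.ball (z₁ : ℂ) ρ)
    (hre : ∫ x in A, (x.re - z₁) = z₁ * (volume.real B - volume.real A))
    (hre' : ∫ x in B, (x.re - z₁) = 0) :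
    |(∫ x in A, ∫ y in S, mirrorKernel x y) - ∫ x in B, ∫ y in S, mirrorKernel x y|
      ≤ 2 * π * ρ ^ 3 / d ^ 2 * volume.real (symmDiff A B) := by
  have hfin : ∀ {T : Set ℂ}, T ⊆ Metric.ball (z₁ : ℂ) ρ → volume T ≠ ⊤ := fun hT =>
    ((measure_mono hT).trans_lt measure_ball_lt_top).ne
  have hz : d / 2 ≤ (z₁ : ℂ).re := half_le_re_of_mem_ball hd hρ (Metric.mem_ball_self hρ₀)
  have hz₁ : 0 < z₁ := hd₀.trans_le hd
  set e := volume.real (symmDiff A B)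
  have he : 0 ≤ e := measureReal_nonneg
  set φ : ℂ → ℝ := fun x => ∫ y in S, mirrorKernel x y with hφ
  have hvol : volume.real S ≤ π * ρ ^ 2 := by
    refine (measureReal_mono hSz measure_ball_lt_top.ne).trans_eq ?_
    rw [Measure.real, Complex.volume_ball]
    simp [ENNReal.toReal_ofReal hρ₀.le, mul_comm]
  have hφz : |φ z₁| ≤ π * ρ ^ 2 / d := by
    have : ‖φ z₁‖ ≤ 1 / d * volume.real S :=
      norm_setIntegral_le_of_norm_le_const (hfin hSz).lt_top fun y hy =>
        abs_mirrorKernel_le hd₀ hz (half_le_re_of_mem_ball hd hρ (hSz hy))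
    refine this.trans ?_
    rw [div_mul_eq_mul_div, one_mul]
    gcongr
  have hosc : ∀ x ∈ A ∪ B, |φ x - φ z₁| ≤ π * ρ ^ 3 / d ^ 2 := by
    intro x hx
    have hxb : x ∈ Metric.ball (z₁ : ℂ) ρ := Set.union_subset hAz hBz hx
    have hx' := half_le_re_of_mem_ball hd hρ hxb
    have hsub : φ x - φ z₁ = ∫ y in S, (mirrorKernel x y - mirrorKernel z₁ y) :=
      (integral_sub (integrableOn_mirrorKernel hd₀ hd hρ hS hSz hx')
        (integrableOn_mirrorKernel hd₀ hd hρ hS hSz hz)).symm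
    rw [hsub]
    have : ‖∫ y in S, (mirrorKernel x y - mirrorKernel z₁ y)‖ ≤ ρ / d ^ 2 * volume.real S := by
      refine norm_setIntegral_le_of_norm_le_const (hfin hSz).lt_top fun y hy => ?_
      refine (abs_mirrorKernel_sub_le hd₀ hx' hz (half_le_re_of_mem_ball hd hρ (hSz hy))).trans ?_
      gcongr
      exact (mem_ball_iff_norm.1 hxb).le
    refine this.trans ?_
    calc ρ / d ^ 2 * volume.real S ≤ ρ / d ^ 2 * (π * ρ ^ 2) := by gcongr
      _ = π * ρ ^ 3 / d ^ 2 := by ring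
  have hIA : IntegrableOn φ A := integrableOn_integral_mirrorKernel hd₀ hd hρ hS hA hSz hAz
  have hIB : IntegrableOn φ B := integrableOn_integral_mirrorKernel hd₀ hd hρ hS hB hSz hBz
  have hcA : IntegrableOn (fun _ : ℂ => φ z₁) A := integrableOn_const (hfin hAz)
  have hcB : IntegrableOn (fun _ : ℂ => φ z₁) B := integrableOn_const (hfin hBz)
  have key := abs_setIntegral_sub_setIntegral_le hA hB (hfin hAz) (hfin hBz)
    (u := fun x => φ x - φ z₁) (hIA.sub hcA) (hIB.sub hcB) hosc
  have hreI : ∀ {T : Set ℂ}, MeasurableSet T → T ⊆ Metric.ball (z₁ : ℂ) ρ →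
      IntegrableOn (fun x : ℂ => x.re - z₁) T := by
    intro T hT hTz
    refine Measure.integrableOn_of_bounded (M := ρ) (hfin hTz)
      (by fun_prop) ?_
    refine (ae_restrict_iff' hT).2 (Eventually.of_forall fun y hy => ?_)
    exact (by simpa using Complex.abs_re_le_norm (y - z₁) : |y.re - z₁| ≤ ‖y - z₁‖).trans
      (mem_ball_iff_norm.1 (hTz hy)).le
  have hreM : ∀ x ∈ A ∪ B, |x.re - z₁| ≤ ρ := fun x hx =>
    (by simpa using Complex.abs_re_le_norm (x - z₁) : |x.re - z₁| ≤ ‖x - z₁‖).trans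
      (mem_ball_iff_norm.1 (Set.union_subset hAz hBz hx)).le
  have key₂ := abs_setIntegral_sub_setIntegral_le hA hB (hfin hAz) (hfin hBz)
    (hreI hA hAz) (hreI hB hBz) hreM
  rw [hre, hre', sub_zero, abs_mul, abs_of_pos hz₁] at key₂
  have harea : |volume.real B - volume.real A| ≤ ρ / d * e := by
    have : d * |volume.real B - volume.real A| ≤ ρ * e :=
      (mul_le_mul_of_nonneg_right hd (abs_nonneg _)).trans key₂
    rw [div_mul_eq_mul_div, le_div_iff₀ hd₀, mul_comm]
    exact this
  rw [integral_sub hIA hcA, integral_sub hIB hcB, setIntegral_const, setIntegral_const,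
    smul_eq_mul, smul_eq_mul] at key
  have hprod : |(volume.real B - volume.real A) * φ z₁| ≤ ρ / d * e * (π * ρ ^ 2 / d) := by
    rw [abs_mul]
    gcongr
  have hfinal := (abs_sub ((∫ x in A, φ x) - volume.real A * φ z₁
      - ((∫ x in B, φ x) - volume.real B * φ z₁)) ((volume.real B - volume.real A) * φ z₁))
  calc |(∫ x in A, φ x) - ∫ x in B, φ x|
      = |((∫ x in A, φ x) - volume.real A * φ z₁
      - ((∫ x in B, φ x) - volume.real B * φ z₁)) - (volume.real B - volume.real A) * φ z₁| := by
        congr 1; ring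
    _ ≤ π * ρ ^ 3 / d ^ 2 * e + ρ / d * e * (π * ρ ^ 2 / d) := hfinal.trans (add_le_add key hprod)
    _ = 2 * π * ρ ^ 3 / d ^ 2 * e := by field_simp; ring

/-- Over a disc the mirror kernel integrates to its value at the centre. -/
theorem setIntegral_ball_mirrorKernel {s : ℝ} (hs : 0 ≤ s) (hsz : s < z₁) {y : ℂ} (hy : 0 < y.re) :
    ∫ x in Metric.ball (z₁ : ℂ) s, mirrorKernel x y = π * s ^ 2 * mirrorKernel z₁ y := by
  have hne : ∀ x ∈ Metric.closedBall (z₁ : ℂ) s, x + starRingEnd ℂ y ≠ 0 := fun x hx =>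
    add_conj_ne_zero (re_pos_of_mem_closedBall hsz hx) hy
  have hd : DifferentiableOn ℂ (fun x => (x + starRingEnd ℂ y)⁻¹) (Metric.closedBall (z₁ : ℂ) s) :=
    (differentiableOn_id.add_const _).inv hne
  have h := setIntegral_ball_of_differentiableOn hs hd
  have hintg : IntegrableOn (fun x : ℂ => (x + starRingEnd ℂ y)⁻¹) (Metric.ball (z₁ : ℂ) s) :=
    (hd.continuousOn.integrableOn_compact (isCompact_closedBall _ _)).mono_set
      Metric.ball_subset_closedBall
  have h' := congrArg Complex.re h
  rw [Complex.re_ofReal_mul] at h'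
  exact (integral_re hintg).trans h'

theorem setIntegral_ball_re {s : ℝ} (hs : 0 ≤ s) :
    ∫ x in Metric.ball (z₁ : ℂ) s, (x.re - z₁) = 0 := by
  have hd : DifferentiableOn ℂ (fun x : ℂ => x - z₁) (Metric.closedBall (z₁ : ℂ) s) := by fun_prop
  have h := setIntegral_ball_of_differentiableOn hs hd
  have hintg : IntegrableOn (fun x : ℂ => x - z₁) (Metric.ball (z₁ : ℂ) s) :=
    (hd.continuousOn.integrableOn_compact (isCompact_closedBall _ _)).mono_set
      Metric.ball_subset_closedBall
  have h' := congrArg Complex.re h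
  rw [Complex.re_ofReal_mul] at h'
  have := (integral_re hintg).trans h'
  simpa using this

theorem setIntegral_ball_prod_mirrorKernel {s : ℝ} (hs : 0 ≤ s) (hsz : s < z₁) :
    ∫ x in Metric.ball (z₁ : ℂ) s, ∫ y in Metric.ball (z₁ : ℂ) s, mirrorKernel x y
      = (π * s ^ 2) ^ 2 / (2 * z₁) := by
  have hz₁ : 0 < z₁ := hs.trans_lt hsz
  have h₁ : ∀ x ∈ Metric.ball (z₁ : ℂ) s, ∫ y in Metric.ball (z₁ : ℂ) s, mirrorKernel x y
      = π * s ^ 2 * mirrorKernel x z₁ := by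
    intro x hx
    simp_rw [mirrorKernel_comm x]
    exact setIntegral_ball_mirrorKernel hs hsz
      (re_pos_of_mem_closedBall hsz (Metric.ball_subset_closedBall hx))
  rw [setIntegral_congr_fun measurableSet_ball h₁, integral_const_mul,
    setIntegral_ball_mirrorKernel hs hsz (by simpa using hz₁)]
  have : mirrorKernel z₁ z₁ = 1 / (2 * z₁) := by
    rw [mirrorKernel, Complex.conj_ofReal, ← Complex.ofReal_add, ← Complex.ofReal_inv,
      Complex.ofReal_re]
    ring
  rw [this]
  ring

/-- The mirror interaction energy of a set with the circulation of a disc is close to that of the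
disc. -/
theorem abs_mirror_energy_sub_le {s : ℝ} (hd₀ : 0 < d) (hd : d ≤ z₁) (hρ₀ : 0 < ρ)
    (hρ : 2 * ρ ≤ d) (hs : 0 ≤ s) (hsρ : s ≤ ρ) {A : Set ℂ} (hA : MeasurableSet A)
    (hAz : A ⊆ Metric.ball (z₁ : ℂ) ρ) (hcirc : ∫ x in A, x.re = z₁ * (π * s ^ 2)) :
    |(∫ p in A ×ˢ A, mirrorKernel p.1 p.2 ∂(volume.prod volume)) - (π * s ^ 2) ^ 2 / (2 * z₁)|
      ≤ 4 * π * ρ ^ 3 / d ^ 2 * volume.real (symmDiff A (Metric.ball (z₁ : ℂ) s)) := by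
  set B := Metric.ball (z₁ : ℂ) s with hBdef
  have hB : MeasurableSet B := measurableSet_ball
  have hBz : B ⊆ Metric.ball (z₁ : ℂ) ρ := Metric.ball_subset_ball hsρ
  have hsz : s < z₁ := by linarith
  have hAf : volume A ≠ ⊤ := ((measure_mono hAz).trans_lt measure_ball_lt_top).ne
  have hBvol : volume.real B = π * s ^ 2 := by
    rw [Measure.real, Complex.volume_ball]
    simp [ENNReal.toReal_ofReal hs, mul_comm]
  have hreI : IntegrableOn (fun x : ℂ => x.re) A :=
    (Complex.continuous_re.continuousOn.integrableOn_compact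
      (isCompact_closedBall (z₁ : ℂ) ρ)).mono_set (hAz.trans Metric.ball_subset_closedBall)
  have hre : ∫ x in A, (x.re - z₁) = z₁ * (volume.real B - volume.real A) := by
    rw [integral_sub hreI (integrableOn_const hAf), hcirc, setIntegral_const, smul_eq_mul, hBvol]
    ring
  have h₁ := abs_setIntegral_mirrorKernel_sub_le hd₀ hd hρ₀ hρ hA hB hA hAz hBz hAz hre
    (setIntegral_ball_re hs)
  have h₂ := abs_setIntegral_mirrorKernel_sub_le hd₀ hd hρ₀ hρ hA hB hB hAz hBz hBz hre
    (setIntegral_ball_re hs)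
  have hswap : ∫ x in B, ∫ y in A, mirrorKernel x y = ∫ x in A, ∫ y in B, mirrorKernel x y := by
    have hI := integrableOn_mirrorKernel_prod hd₀ hd hρ hB hA hBz hAz
    rw [IntegrableOn, ← Measure.prod_restrict] at hI
    rw [integral_integral_swap hI]
    simp_rw [mirrorKernel_comm]
  rw [hswap] at h₁
  rw [← setIntegral_ball_prod_mirrorKernel hs hsz,
    setIntegral_prod _ (integrableOn_mirrorKernel_prod hd₀ hd hρ hA hA hAz hAz)]
  refine (abs_sub_le _ (∫ x in A, ∫ y in B, mirrorKernel x y) _).trans ?_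
  calc _ ≤ _ := add_le_add h₁ h₂
    _ = _ := by ring

end Estimate

/-- The identification of `ℂ` with the plane. -/
def planeEquiv : ℂ ≃ₗᵢ[ℝ] Plane := Complex.orthonormalBasisOneI.repr

@[simp]
theorem planeEquiv_apply_zero (w : ℂ) : planeEquiv w 0 = w.re := by
  simp [planeEquiv]

@[simp]
theorem planeEquiv_apply_one (w : ℂ) : planeEquiv w 1 = w.im := by
  simp [planeEquiv]

theorem mk2_eq_planeEquiv (a : ℝ) : mk2 a 0 = planeEquiv a := by
  ext i
  fin_cases i <;> simp [mk2]

theorem reflPt_planeEquiv (x : ℂ) : reflPt (planeEquiv x) = planeEquiv (-starRingEnd ℂ x) := by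
  ext i
  fin_cases i <;> simp [mk2, reflPt]

theorem measurableEmbedding_planeEquiv : MeasurableEmbedding planeEquiv :=
  planeEquiv.toHomeomorph.measurableEmbedding

theorem setIntegral_plane (S : Set Plane) (f : Plane → ℝ) :
    ∫ x in S, f x = ∫ w in planeEquiv ⁻¹' S, f (planeEquiv w) :=
  (planeEquiv.measurePreserving.setIntegral_preimage_emb measurableEmbedding_planeEquiv f S).symm

theorem setIntegral_plane_hausdorff (S : Set Plane) (f : Plane → ℝ) :
    ∫ x in S, f x ∂μH[1] = ∫ w in planeEquiv ⁻¹' S, f (planeEquiv w) ∂μH[1] :=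
  ((planeEquiv.toIsometryEquiv.measurePreserving_hausdorffMeasure 1).setIntegral_preimage_emb
    measurableEmbedding_planeEquiv f S).symm

theorem HasGradientAt.of_comp_planeEquiv {ψ : Plane → ℝ} {w G : ℂ}
    (h : HasGradientAt (fun y => ψ (planeEquiv y)) G w) :
    HasGradientAt ψ (planeEquiv G) (planeEquiv w) := by
  have h₁ : HasFDerivAt (fun y => ψ (planeEquiv y)) (InnerProductSpace.toDual ℝ ℂ G)
      (planeEquiv.symm (planeEquiv w)) := by
    rw [LinearIsometryEquiv.symm_apply_apply]; exact h.hasFDerivAt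
  have h₂ := h₁.comp (planeEquiv w)
    (planeEquiv.symm.toContinuousLinearEquiv.hasFDerivAt (x := planeEquiv w))
  have h₃ : HasFDerivAt ψ (InnerProductSpace.toDual ℝ Plane (planeEquiv G)) (planeEquiv w) := by
    refine (h₂.congr_fderiv (ContinuousLinearMap.ext fun v => ?_)).congr_of_eventuallyEq
      (Eventually.of_forall fun y => ?_)
    · obtain ⟨v, rfl⟩ := planeEquiv.surjective v
      simp [LinearIsometryEquiv.inner_map_map, -Complex.inner]
    · simp
  exact h₃

/-- **Boundary Pohozaev integral of the concentrated potential** (cf. Lemma C.3 / proof of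
Proposition 3.3). For `A ⊆ B_{Rε}(z)` with circulation `κ ∈ [κ₁, κ₀]` differing from the
disc `B_{s₀}(z)` by measure `e ≤ Kε`, the Pohozaev boundary integral of the potential `ψ₁`
over `∂B_δ(z)` equals `κ² z₁/(4π)` up to `C e/ε`. -/
theorem pohozaev_boundary_concentrated (δ₀ κ₁ κ₀ R K δ : ℝ)
    (hδ₀ : 0 < δ₀) (hκ₁ : 0 < κ₁) (hκ : κ₁ ≤ κ₀) (hR : 0 < R) (hK : 0 < K)
    (hδ : 0 < δ) (hδ' : δ ≤ δ₀ / 2) :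
    ∃ C > (0 : ℝ), ∃ ε₀ > (0 : ℝ), ∀ ε ∈ Set.Ioc (0 : ℝ) ε₀,
      ∀ z₁ : ℝ, δ₀ ≤ z₁ → z₁ ≤ 1 / δ₀ →
      ∀ A : Set Plane, MeasurableSet A → A ⊆ Metric.ball (mk2 z₁ 0) (R * ε) →
      ∀ κ : ℝ, κ = (∫ x in A, x 0) / ε ^ 2 → κ₁ ≤ κ → κ ≤ κ₀ →
      ∀ s₀ : ℝ, s₀ = ε * Real.sqrt (κ / (π * z₁)) →
      ∀ e : ℝ, e = (volume (symmDiff A (Metric.ball (mk2 z₁ 0) s₀))).toReal → e ≤ K * ε →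
      ∀ ψ₁ : Plane → ℝ,
        ψ₁ = (fun y =>
          z₁ ^ 2 / (2 * π * ε ^ 2) * ∫ x' in A, Real.log (‖y - reflPt x'‖ / ‖y - x'‖)) →
      ∀ z : Plane, z = mk2 z₁ 0 →
        |-(∫ x in Metric.sphere z δ,
              (⟪gradient ψ₁ x, x - z⟫ / δ) * (gradient ψ₁ x 0) ∂μH[1])
            + (1 / 2) *
              (∫ x in Metric.sphere z δ, ‖gradient ψ₁ x‖ ^ 2 * ((x 0 - z 0) / δ) ∂μH[1])
            - κ ^ 2 * z₁ / (4 * π)|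
          ≤ C * e / ε := by
  set R' := R + √(κ₀ / (π * δ₀)) with hR'
  have hR'₀ : 0 < R' := by positivity
  refine ⟨2 * R' ^ 3 / δ₀ ^ 6, by positivity, δ / (2 * R'), by positivity, ?_⟩
  rintro ε ⟨hε, hεle⟩ z₁ hz hz' A hA hAz κ hκA hκ₁' hκ₀' s₀ rfl e rfl - ψ₁ rfl z rfl
  have hz₁ : 0 < z₁ := hδ₀.trans_le hz
  have hκpos : 0 < κ := hκ₁.trans_le hκ₁'
  have hρδ : R' * ε ≤ δ / 2 := by
    rw [le_div_iff₀ (by positivity)] at hεle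
    linarith
  set ρ := R' * ε with hρ
  have hρ₀ : 0 < ρ := by positivity
  set s₀ := ε * √(κ / (π * z₁)) with hs₀
  have hs₀' : 0 ≤ s₀ := by positivity
  have hs₀ρ : s₀ ≤ ρ := by
    have h : √(κ / (π * z₁)) ≤ √(κ₀ / (π * δ₀)) := by
      apply Real.sqrt_le_sqrt
      gcongr
      exact hκpos.le.trans hκ₀'
    rw [hs₀, hρ, mul_comm]
    gcongr
    linarith
  have hs₀sq : π * s₀ ^ 2 = ε ^ 2 * κ / z₁ := by
    rw [hs₀, mul_pow, Real.sq_sqrt (by positivity)]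
    field_simp
  set A' : Set ℂ := planeEquiv ⁻¹' A with hA'
  have hA'm : MeasurableSet A' := measurableEmbedding_planeEquiv.measurable hA
  have hball : ∀ r : ℝ, planeEquiv ⁻¹' Metric.ball (planeEquiv z₁) r = Metric.ball (z₁ : ℂ) r :=
    fun r => planeEquiv.isometry.preimage_ball _ r
  have hsphere : planeEquiv ⁻¹' Metric.sphere (planeEquiv z₁) δ = Metric.sphere (z₁ : ℂ) δ :=
    planeEquiv.isometry.preimage_sphere _ δ
  rw [mk2_eq_planeEquiv] at *
  have hA'ρ : A' ⊆ Metric.ball (z₁ : ℂ) ρ := by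
    rw [← hball]
    refine Set.preimage_mono (hAz.trans (Metric.ball_subset_ball ?_))
    rw [hρ]
    gcongr
    rw [hR']
    linarith [Real.sqrt_nonneg (κ₀ / (π * δ₀))]
  have hA'δ : A' ⊆ Metric.ball (z₁ : ℂ) (δ / 2) := hA'ρ.trans (Metric.ball_subset_ball hρδ)
  have hcirc : ∫ x in A', x.re = z₁ * (π * s₀ ^ 2) := by
    have h : ∫ x in A, x 0 = ∫ w in A', w.re := by
      simpa using setIntegral_plane A (fun x => x 0)
    rw [← h, hs₀sq, hκA]
    field_simp
  have hvol : (volume (symmDiff A (Metric.ball (planeEquiv z₁) s₀))).toReal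
      = volume.real (symmDiff A' (Metric.ball (z₁ : ℂ) s₀)) := by
    rw [← hball, hA', ← Set.preimage_symmDiff, Measure.real,
      planeEquiv.measurePreserving.measure_preimage
        (hA.symmDiff measurableSet_ball).nullMeasurableSet]
  set c := z₁ ^ 2 / (2 * π * ε ^ 2) with hc
  set ψ : Plane → ℝ := fun y => c * ∫ x' in A, Real.log (‖y - reflPt x'‖ / ‖y - x'‖) with hψ
  have hψ' : ∀ y : ℂ, ψ (planeEquiv y)
      = c * ∫ x in A', Real.log (‖y + starRingEnd ℂ x‖ / ‖y - x‖) := by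
    intro y
    simp only [hψ]
    rw [setIntegral_plane]
    simp_rw [reflPt_planeEquiv, ← map_sub, LinearIsometryEquiv.norm_map, sub_neg_eq_add]
    rfl
  have hgrad : ∀ w ∈ Metric.sphere (z₁ : ℂ) δ,
      gradient ψ (planeEquiv w) = planeEquiv (c * starRingEnd ℂ (dipoleField A' w)) := by
    intro w hw
    apply HasGradientAt.gradient
    apply HasGradientAt.of_comp_planeEquiv
    simp_rw [hψ']
    exact hasGradientAt_integral_log hδ (by linarith) hA'm hA'δ c hw
  have hbdry := boundary_integral_eq_mirrorKernel hδ (by linarith : 2 * δ ≤ z₁) hA'm hA'δ c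
    (G := fun w => planeEquiv.symm (gradient ψ (planeEquiv w))) (fun w hw => by
      simp only [hgrad w hw, LinearIsometryEquiv.symm_apply_apply])
  have hre : ∀ x : Plane, (planeEquiv.symm x).re = x 0 := fun x => by
    rw [← planeEquiv_apply_zero, LinearIsometryEquiv.apply_symm_apply]
  have hinner : ∀ (x : Plane) (w : ℂ), ⟪planeEquiv.symm x, w⟫ = ⟪x, planeEquiv w⟫ := fun x w => by
    rw [← planeEquiv.inner_map_map, LinearIsometryEquiv.apply_symm_apply]
  simp_rw [hre, hinner, LinearIsometryEquiv.norm_map, map_sub] at hbdry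
  rw [setIntegral_plane_hausdorff, setIntegral_plane_hausdorff, hsphere, hvol]
  simp_rw [planeEquiv_apply_zero, Complex.ofReal_re]
  rw [hbdry]
  have hest := abs_mirror_energy_sub_le hδ₀ hz hρ₀ (by linarith) hs₀' hs₀ρ hA'm hA'ρ hcirc
  set Q := ∫ p in A' ×ˢ A', mirrorKernel p.1 p.2 ∂(volume.prod volume)
  set e := volume.real (symmDiff A' (Metric.ball (z₁ : ℂ) s₀))
  have he : 0 ≤ e := measureReal_nonneg
  have hmain : κ ^ 2 * z₁ / (4 * π) = 2 * π * c ^ 2 * ((π * s₀ ^ 2) ^ 2 / (2 * z₁)) := by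
    rw [hs₀sq, hc]
    field_simp
    ring
  rw [hmain, ← mul_sub, abs_mul, abs_of_nonneg (by positivity)]
  calc 2 * π * c ^ 2 * |Q - (π * s₀ ^ 2) ^ 2 / (2 * z₁)|
      ≤ 2 * π * c ^ 2 * (4 * π * ρ ^ 3 / δ₀ ^ 2 * e) := by gcongr
    _ = z₁ ^ 4 * (2 * R' ^ 3 / δ₀ ^ 2 * e / ε) := by
        rw [hc, hρ]
        field_simp
        ring
    _ ≤ (1 / δ₀) ^ 4 * (2 * R' ^ 3 / δ₀ ^ 2 * e / ε) := by gcongr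
    _ = 2 * R' ^ 3 / δ₀ ^ 6 * e / ε := by
        field_simp
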